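/- Let U¹, V¹ be nonzero finite-dimensional complex vector spaces and U², V² complex vector spaces. Let μ_U : U¹ × U¹ → U² and μ_V : V¹ × V¹ → V² be ℂ-bilinear alternating maps, and define the bilinear alternating map μ = μ_U * μ_V on W¹ = U¹ × V¹ with values in W² = U² × V² by μ((a,b),(x,y)) = (μ_U(a,x), μ_V(b,y)) (so μ restricts to μ_U on U¹, to μ_V on V¹, and vanishes on mixed pairs). Assume that W¹ is either 0-isotropic with respect to μ (i.e., μ = 0) or 1-isotropic with respect to μ (i.e., the span of the image of μ is one-dimensional and μ is non-degenerate: for every nonzero w ∈ W¹ there is w' ∈ W¹ with μ(w,w') ≠ 0). Then μ_U = 0 and μ_V = 0. -/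

import Mathlib

/-- Lemma 9.2: let `μ_U`, `μ_V` be bilinear alternating maps on nonzero finite-dimensional
complex vector spaces `U¹`, `V¹`, and let `μ = μ_U * μ_V` be the induced alternating map on
`W¹ = U¹ × V¹` given by `μ((a,b),(x,y)) = (μ_U(a,x), μ_V(b,y))`. If `W¹` is `0`-isotropic
(`μ = 0`) or `1`-isotropic (the span of the image of `μ` is one-dimensional and `μ` is
non-degenerate) with respect to `μ`, then `μ_U = 0` and `μ_V = 0`. -/
theorem coproduct_isotropic_implies_zero
    {U1 V1 U2 V2 : Type*}
    [AddCommGroup U1] [Module ℂ U1] [AddCommGroup V1] [Module ℂ V1]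
    [AddCommGroup U2] [Module ℂ U2] [AddCommGroup V2] [Module ℂ V2]
    [FiniteDimensional ℂ U1] [FiniteDimensional ℂ V1] [Nontrivial U1] [Nontrivial V1]
    (μU : U1 →ₗ[ℂ] U1 →ₗ[ℂ] U2) (μV : V1 →ₗ[ℂ] V1 →ₗ[ℂ] V2)
    (hU : ∀ a : U1, μU a a = 0) (hV : ∀ b : V1, μV b b = 0)
    (h : (∀ p q : U1 × V1, (μU p.1 q.1, μV p.2 q.2) = (0 : U2 × V2)) ∨
      (Module.finrank ℂ (Submodule.span ℂ
          {w : U2 × V2 | ∃ p q : U1 × V1, (μU p.1 q.1, μV p.2 q.2) = w}) = 1 ∧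
        ∀ p : U1 × V1, p ≠ 0 → ∃ q : U1 × V1, (μU p.1 q.1, μV p.2 q.2) ≠ (0 : U2 × V2))) :
    μU = 0 ∧ μV = 0 := by
  rcases h with h | ⟨h1, hnd⟩
  · constructor
    · ext a x
      exact congrArg Prod.fst (h (a, 0) (x, 0))
    · ext b y
      exact congrArg Prod.snd (h (0, b) (0, y))
  · exfalso
    obtain ⟨a, ha⟩ := exists_ne (0 : U1)
    obtain ⟨b, hb⟩ := exists_ne (0 : V1)
    obtain ⟨p, hp⟩ := hnd (a, 0) (by simpa using ha)
    obtain ⟨q, hq⟩ := hnd (0, b) (by simpa using hb)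
    obtain ⟨c, hc⟩ := (finrank_eq_one_iff_of_nonzero'
      (⟨_, Submodule.subset_span ⟨(a, 0), p, rfl⟩⟩ : Submodule.span ℂ
        {w : U2 × V2 | ∃ p q : U1 × V1, (μU p.1 q.1, μV p.2 q.2) = w})
      (fun h0 => hp (congrArg Subtype.val h0))).1 h1
      ⟨_, Submodule.subset_span ⟨(0, b), q, rfl⟩⟩
    have hsnd := congrArg (fun w => w.1.2) hc
    simp only [Submodule.coe_smul, Prod.smul_snd, map_zero, LinearMap.zero_apply,
      smul_zero] at hsnd
    exact hq (by simp [← hsnd])
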